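/- Let 0≤α<2n and R⃗=(r₁,r₂). Assume 0<r_i<q_i<∞ (i=1,2) and let 1/q=1/q₁+1/q₂. If 0<t≤s<∞ and 0<q≤p<∞ satisfy 1/s=1/p−α/n and t/s=q/p, then there is a constant C such that for all measurable f,g, ‖M_{α,R⃗}(f,g)‖_{M_t^s} ≤ C · sup_{Q∈D(ℝ^n)} |Q|^{1/p} (⨍_Q |f(y)|^{q₁}dy)^{1/q₁} (⨍_Q |g(z)|^{q₂}dz)^{1/q₂}. -/

import Mathlib

open MeasureTheory ENNReal

noncomputable section

/-- The dyadic cube `2^{-k}([0,1)^n + m)` in `ℝ^n`. -/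
def dyadicCube (n : ℕ) (k : ℤ) (m : Fin n → ℤ) : Set (EuclideanSpace ℝ (Fin n)) :=
  {x | ∀ i, (m i : ℝ) ≤ (2 : ℝ) ^ k * x i ∧ (2 : ℝ) ^ k * x i < (m i : ℝ) + 1}

/-- The concentric triple `3Q` of the dyadic cube with parameters `k, m`. -/
def tripleCube (n : ℕ) (k : ℤ) (m : Fin n → ℤ) : Set (EuclideanSpace ℝ (Fin n)) :=
  {x | ∀ i, (m i : ℝ) - 1 ≤ (2 : ℝ) ^ k * x i ∧ (2 : ℝ) ^ k * x i < (m i : ℝ) + 2}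

/-- `Q` is a dyadic cube. -/
def IsDyadicCube {n : ℕ} (Q : Set (EuclideanSpace ℝ (Fin n))) : Prop :=
  ∃ (k : ℤ) (m : Fin n → ℤ), Q = dyadicCube n k m

/-- A (closed) cube with sides parallel to the axes. -/
def IsCube {n : ℕ} (Q : Set (EuclideanSpace ℝ (Fin n))) : Prop :=
  ∃ (a : EuclideanSpace ℝ (Fin n)) (d : ℝ), 0 < d ∧
    Q = {x | ∀ i, a i ≤ x i ∧ x i ≤ a i + d}

/-- The average `⨍_Q f` of an `ℝ≥0∞`-valued function. -/
def setAvg {n : ℕ} (Q : Set (EuclideanSpace ℝ (Fin n)))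
    (f : EuclideanSpace ℝ (Fin n) → ℝ≥0∞) : ℝ≥0∞ :=
  (volume Q)⁻¹ * ∫⁻ x in Q, f x

/-- The mean `m_Q(b)` of a real-valued function. -/
def setMean {n : ℕ} (Q : Set (EuclideanSpace ℝ (Fin n)))
    (b : EuclideanSpace ℝ (Fin n) → ℝ) : ℝ :=
  (∫ x in Q, b x) / (volume Q).toReal

/-- The (dyadic) Morrey norm `‖f‖_{M_q^p}` (first exponent `p`, second `q`). -/
def morreyNorm {n : ℕ} (p q : ℝ) (f : EuclideanSpace ℝ (Fin n) → ℝ≥0∞) : ℝ≥0∞ :=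
  ⨆ (Q : Set (EuclideanSpace ℝ (Fin n))) (_ : IsDyadicCube Q),
    volume Q ^ (1 / p) * (setAvg Q fun x => f x ^ q) ^ (1 / q)

/-- The weighted Morrey norm `‖f‖_{M_q^p(w)}` (supremum over all cubes). -/
def wMorreyNorm {n : ℕ} (p q : ℝ) (w f : EuclideanSpace ℝ (Fin n) → ℝ≥0∞) : ℝ≥0∞ :=
  ⨆ (Q : Set (EuclideanSpace ℝ (Fin n))) (_ : IsCube Q),
    (∫⁻ x in Q, w x) ^ (1 / p - 1 / q) * (∫⁻ x in Q, f x ^ q * w x) ^ (1 / q)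

/-- The bilinear fractional integral operator `B_α`. -/
def Bop {n : ℕ} (α : ℝ) (f g : EuclideanSpace ℝ (Fin n) → ℝ)
    (x : EuclideanSpace ℝ (Fin n)) : ℝ :=
  ∫ y, f (x - y) * g (x + y) * ‖y‖ ^ (α - (n : ℝ))

/-- The bilinear fractional maximal operator `M_{α,R⃗}`, `R⃗ = (r₁, r₂)`. -/
def Mop {n : ℕ} (α r₁ r₂ : ℝ) (f g : EuclideanSpace ℝ (Fin n) → ℝ≥0∞)
    (x : EuclideanSpace ℝ (Fin n)) : ℝ≥0∞ :=
  ⨆ (Q : Set (EuclideanSpace ℝ (Fin n))) (_ : IsDyadicCube Q) (_ : x ∈ Q),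
    volume Q ^ (α / (n : ℝ)) * (setAvg Q fun y => f y ^ r₁) ^ (1 / r₁) *
      (setAvg Q fun z => g z ^ r₂) ^ (1 / r₂)

/-- The BMO norm `‖b‖_{BMO}` (supremum over all axes-parallel cubes). -/
def bmoNorm {n : ℕ} (b : EuclideanSpace ℝ (Fin n) → ℝ) : ℝ≥0∞ :=
  ⨆ (Q : Set (EuclideanSpace ℝ (Fin n))) (_ : IsCube Q),
    setAvg Q fun x => ENNReal.ofReal |b x - setMean Q b|

/-- The conjugate exponent `e' = e / (e - 1)`. -/
def conjExp (e : ℝ) : ℝ := e / (e - 1)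

abbrev BilinOp (n : ℕ) :=
  (EuclideanSpace ℝ (Fin n) → ℝ) → (EuclideanSpace ℝ (Fin n) → ℝ) →
    EuclideanSpace ℝ (Fin n) → ℝ

/-- The commutator `[b,T]_β` of a bilinear operator; `β = 0` acts on the first slot,
`β = 1` on the second. -/
def commut {n : ℕ} (β : Fin 2) (b : EuclideanSpace ℝ (Fin n) → ℝ) (T : BilinOp n) :
    BilinOp n := fun f g x =>
  if β = 0 then b x * T f g x - T (fun y => b y * f y) g x
  else b x * T f g x - T f (fun y => b y * g y) x

/-- The iterated commutator `[b⃗,T]_{β⃗} = [b_N,[…,[b₁,T]_{β₁}…]_{β_N}]`. -/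
def iterComm {n : ℕ} : (N : ℕ) → (Fin N → EuclideanSpace ℝ (Fin n) → ℝ) →
    (Fin N → Fin 2) → BilinOp n → BilinOp n
  | 0, _, _, T => T
  | (N + 1), b, β, T =>
      commut (β (Fin.last N)) (b (Fin.last N))
        (iterComm N (fun i => b i.castSucc) (fun i => β i.castSucc) T)

/-- The Muckenhoupt class `A_p`. -/
def IsAp {n : ℕ} (p : ℝ) (w : EuclideanSpace ℝ (Fin n) → ℝ≥0∞) : Prop :=
  ∃ C : ℝ≥0∞, C ≠ ∞ ∧ ∀ Q, IsCube Q →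
    setAvg Q w * (setAvg Q fun x => w x ^ (1 - conjExp p)) ^ (p - 1) ≤ C

/-- The class `A_∞ = ⋃_{p>1} A_p`. -/
def IsAinfty {n : ℕ} (w : EuclideanSpace ℝ (Fin n) → ℝ≥0∞) : Prop :=
  ∃ p : ℝ, 1 < p ∧ IsAp p w

/-- The reverse Hölder class `RH_ν`. -/
def IsRH {n : ℕ} (ν : ℝ) (w : EuclideanSpace ℝ (Fin n) → ℝ≥0∞) : Prop :=
  ∃ C : ℝ≥0∞, C ≠ ∞ ∧ ∀ Q, IsCube Q →
    (setAvg Q fun x => w x ^ ν) ^ (1 / ν) ≤ C * setAvg Q w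

/-- The bilinear maximal function associated to the bilinear Hilbert transform. -/
def BHop {n : ℕ} (f g : EuclideanSpace ℝ (Fin n) → ℝ)
    (x : EuclideanSpace ℝ (Fin n)) : ℝ≥0∞ :=
  ⨆ (ρ : ℝ) (_ : 0 < ρ),
    (ENNReal.ofReal ((2 * ρ) ^ n))⁻¹ *
      ∫⁻ y in {y : EuclideanSpace ℝ (Fin n) | ∀ i, |y i| ≤ ρ},
        ENNReal.ofReal |f (x - y) * g (x + y)|

/-- The factor `(⨍_Q v^{at/(1-t)})^{(1-t)/(at)}`, interpreted as `‖v‖_{L^∞(Q)}` when `t = 1`. -/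
def vFactor {n : ℕ} (a t : ℝ) (v : EuclideanSpace ℝ (Fin n) → ℝ≥0∞)
    (Q : Set (EuclideanSpace ℝ (Fin n))) : ℝ≥0∞ :=
  if t = 1 then essSup v (volume.restrict Q)
  else (setAvg Q fun x => v x ^ (a * t / (1 - t))) ^ ((1 - t) / (a * t))

/-- `sup_Q |Q|^{1/p} (⨍_Q (|f|w₁)^{q₁})^{1/q₁} (⨍_Q (|g|w₂)^{q₂})^{1/q₂}`. -/
def inputNorm {n : ℕ} (p q₁ q₂ : ℝ) (w₁ w₂ : EuclideanSpace ℝ (Fin n) → ℝ≥0∞)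
    (f g : EuclideanSpace ℝ (Fin n) → ℝ) : ℝ≥0∞ :=
  ⨆ (Q : Set (EuclideanSpace ℝ (Fin n))) (_ : IsDyadicCube Q),
    volume Q ^ (1 / p) *
      (setAvg Q fun x => (ENNReal.ofReal |f x| * w₁ x) ^ q₁) ^ (1 / q₁) *
      (setAvg Q fun x => (ENNReal.ofReal |g x| * w₂ x) ^ q₂) ^ (1 / q₂)

/-- `sup_Q |Q|^{1/p} (⨍_Q |f|^{q₁} u₁)^{1/q₁} (⨍_Q |g|^{q₂} u₂)^{1/q₂}`. -/
def inputNormW {n : ℕ} (p q₁ q₂ : ℝ) (u₁ u₂ : EuclideanSpace ℝ (Fin n) → ℝ≥0∞)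
    (f g : EuclideanSpace ℝ (Fin n) → ℝ) : ℝ≥0∞ :=
  ⨆ (Q : Set (EuclideanSpace ℝ (Fin n))) (_ : IsDyadicCube Q),
    volume Q ^ (1 / p) *
      (setAvg Q fun x => ENNReal.ofReal |f x| ^ q₁ * u₁ x) ^ (1 / q₁) *
      (setAvg Q fun x => ENNReal.ofReal |g x| ^ q₂ * u₂ x) ^ (1 / q₂)


/-- The average of `h` over the cell of `c` containing `x`. -/
def cellAvg {X ι : Type*} [MeasurableSpace X] (μ : Measure X) (c : X → ι) (h : X → ℝ≥0∞)
    (x : X) : ℝ≥0∞ :=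
  (μ (c ⁻¹' {c x}))⁻¹ * ∫⁻ y in c ⁻¹' {c x}, h y ∂μ

/-- The martingale maximal function of a sequence of partitions into the cells of `c i`. -/
def cellMax {X ι : Type*} [MeasurableSpace X] (μ : Measure X) (c : ℕ → X → ι) (h : X → ℝ≥0∞)
    (x : X) : ℝ≥0∞ :=
  ⨆ i, cellAvg μ (c i) h x

section Maximal

variable {X ι : Type*} [MeasurableSpace X] {μ : Measure X}

theorem cellAvg_congr {c : X → ι} {h : X → ℝ≥0∞} {x y : X} (hxy : c x = c y) :
    cellAvg μ c h x = cellAvg μ c h y := by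
  simp only [cellAvg, hxy]

theorem mul_measure_cellMax_lt_le [Countable ι] [MeasurableSpace ι] [DiscreteMeasurableSpace ι]
    {c : ℕ → X → ι} (hc : ∀ i, Measurable (c i))
    (href : ∀ i x y, c (i + 1) x = c (i + 1) y → c i x = c i y)
    (h : X → ℝ≥0∞) (l : ℝ≥0∞) :
    l * μ {x | l < cellMax μ c h x} ≤ ∫⁻ x, h x ∂μ := by
  have href' : ∀ i j x y, j ≤ i → c i x = c i y → c j x = c j y := by
    intro i j x y hji
    induction i, hji using Nat.le_induction with
    | base => exact id
    | succ i _ ih => exact fun hxy => ih (href i x y hxy)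
  let S : Set (ℕ × ι) := {z | ∀ x ∈ c z.1 ⁻¹' {z.2},
    l < cellAvg μ (c z.1) h x ∧ ∀ j < z.1, cellAvg μ (c j) h x ≤ l}
  let B : S → Set X := fun z => c z.1.1 ⁻¹' {z.1.2}
  have hBm : ∀ z, MeasurableSet (B z) := fun z => hc _ (measurableSet_singleton _)
  have hB : ∀ z, l * μ (B z) ≤ ∫⁻ x in B z, h x ∂μ := by
    intro z
    rcases (B z).eq_empty_or_nonempty with he | ⟨x, hx⟩
    · simp [he]
    · have h1 := (z.2 x hx).1
      have hx' : c z.1.1 x = z.1.2 := hx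
      rw [cellAvg, hx'] at h1
      refine ENNReal.mul_le_of_le_div ?_
      rw [ENNReal.div_eq_inv_mul]
      exact h1.le
  have hdisj : Pairwise (Function.onFun Disjoint B) := by
    intro z w hzw
    refine Set.disjoint_left.2 fun x hxz hxw => hzw ?_
    have hz := z.2 x hxz
    have hw := w.2 x hxw
    have hi : z.1.1 = w.1.1 := by
      rcases lt_trichotomy z.1.1 w.1.1 with hlt | heq | hlt
      · exact absurd hz.1 (not_lt.2 (hw.2 _ hlt))
      · exact heq
      · exact absurd hw.1 (not_lt.2 (hz.2 _ hlt))
    have hxz' : c z.1.1 x = z.1.2 := hxz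
    have hxw' : c w.1.1 x = w.1.2 := hxw
    exact Subtype.ext (Prod.ext hi (by rw [← hxz', ← hxw', hi]))
  have hsub : {x | l < cellMax μ c h x} ⊆ ⋃ z, B z := by
    intro x hx
    have hex : ∃ i, l < cellAvg μ (c i) h x := lt_iSup_iff.1 hx
    classical
    refine Set.mem_iUnion.2 ⟨⟨(Nat.find hex, c (Nat.find hex) x), ?_⟩, rfl⟩
    intro y hy
    have hy' : c (Nat.find hex) y = c (Nat.find hex) x := hy
    refine ⟨?_, fun j hj => ?_⟩
    · rw [cellAvg_congr hy']
      exact Nat.find_spec hex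
    · rw [cellAvg_congr (href' _ j _ _ hj.le hy')]
      exact not_lt.1 (Nat.find_min hex hj)
  calc l * μ {x | l < cellMax μ c h x} ≤ l * ∑' z, μ (B z) := by
        gcongr
        exact (measure_mono hsub).trans (measure_iUnion_le _)
    _ = ∑' z, l * μ (B z) := ENNReal.tsum_mul_left.symm
    _ ≤ ∑' z, ∫⁻ x in B z, h x ∂μ := ENNReal.tsum_le_tsum hB
    _ = ∫⁻ x in ⋃ z, B z, h x ∂μ := (lintegral_iUnion hBm hdisj _).symm
    _ ≤ ∫⁻ x, h x ∂μ := setLIntegral_le_lintegral _ _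

theorem cellAvg_le_add {c : X → ι} {h : X → ℝ≥0∞} (hh : Measurable h) (l : ℝ≥0∞) (x : X) :
    cellAvg μ c h x ≤ cellAvg μ c ({y | l < h y}.indicator h) x + l := by
  have hle : ∀ y, h y ≤ {y | l < h y}.indicator h y + l := by
    intro y
    by_cases hy : l < h y
    · simp [hy]
    · simp [hy, not_lt.1 hy]
  have hm : Measurable ({y | l < h y}.indicator h) :=
    hh.indicator (measurableSet_lt measurable_const hh)
  unfold cellAvg
  set s := c ⁻¹' {c x}
  calc (μ s)⁻¹ * ∫⁻ y in s, h y ∂μ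
      ≤ (μ s)⁻¹ * ∫⁻ y in s, ({y | l < h y}.indicator h y + l) ∂μ := by
        gcongr with y
        exact hle y
    _ = (μ s)⁻¹ * ∫⁻ y in s, {y | l < h y}.indicator h y ∂μ + l * ((μ s)⁻¹ * μ s) := by
        rw [lintegral_add_left hm, setLIntegral_const]
        ring
    _ ≤ _ := by
        gcongr
        exact mul_le_of_le_one_right' (ENNReal.inv_mul_le_one _)

theorem mul_measure_two_mul_lt_cellMax_le [Countable ι] [MeasurableSpace ι]
    [DiscreteMeasurableSpace ι] {c : ℕ → X → ι} (hc : ∀ i, Measurable (c i))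
    (href : ∀ i x y, c (i + 1) x = c (i + 1) y → c i x = c i y)
    {h : X → ℝ≥0∞} (hh : Measurable h) {l : ℝ≥0∞} (hl : l ≠ ∞) :
    l * μ {x | 2 * l < cellMax μ c h x} ≤ ∫⁻ x, {y | l < h y}.indicator h x ∂μ := by
  refine le_trans ?_ (mul_measure_cellMax_lt_le hc href _ l)
  gcongr l * μ ?_
  intro x hx
  have hx' : 2 * l < ⨆ i, cellAvg μ (c i) h x := hx
  obtain ⟨i, hi⟩ := lt_iSup_iff.1 hx'
  refine (lt_iSup_iff (f := fun i => cellAvg μ (c i) _ x)).2 ⟨i, ?_⟩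
  have := hi.trans_le (cellAvg_le_add hh l x)
  rw [two_mul] at this
  exact (ENNReal.add_lt_add_iff_right hl).1 this

theorem measurable_cellMax [Countable ι] [MeasurableSpace ι] [DiscreteMeasurableSpace ι]
    {c : ℕ → X → ι} (hc : ∀ i, Measurable (c i)) (h : X → ℝ≥0∞) :
    Measurable (cellMax μ c h) := by
  refine Measurable.iSup fun i => ?_
  exact (measurable_of_countable
    fun m => (μ (c i ⁻¹' {m}))⁻¹ * ∫⁻ y in c i ⁻¹' {m}, h y ∂μ).comp (hc i)

theorem lintegral_Ioo_rpow {b z : ℝ} (hb : 0 < b) (hz : 0 ≤ z) :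
    ∫⁻ l in Set.Ioo 0 z, ENNReal.ofReal (l ^ (b - 1)) = ENNReal.ofReal (z ^ b / b) := by
  have hint : IntegrableOn (fun l : ℝ => l ^ (b - 1)) (Set.Ioo 0 z) := by
    have := intervalIntegral.intervalIntegrable_rpow' (a := 0) (b := z) (r := b - 1) (by linarith)
    rw [intervalIntegrable_iff_integrableOn_Ioo_of_le hz] at this
    exact this
  rw [← ofReal_integral_eq_lintegral_ofReal hint, ← integral_Ioc_eq_integral_Ioo,
    ← intervalIntegral.integral_of_le hz, integral_rpow (Or.inl (by linarith))]
  · simp [Real.zero_rpow hb.ne']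
  · filter_upwards [ae_restrict_mem measurableSet_Ioo] with l hl
    exact Real.rpow_nonneg hl.1.le _

/-- The layer cake formula for a power of an extended nonnegative number. -/
theorem lintegral_rpow_indicator_lt {b : ℝ} (hb : 0 < b) (y : ℝ≥0∞) :
    ∫⁻ l in Set.Ioi (0 : ℝ), {l : ℝ | ENNReal.ofReal l < y}.indicator
      (fun l => ENNReal.ofReal (l ^ (b - 1))) l = y ^ b / ENNReal.ofReal b := by
  have hset : MeasurableSet {l : ℝ | ENNReal.ofReal l < y} :=
    measurableSet_lt ENNReal.measurable_ofReal measurable_const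
  rw [lintegral_indicator hset, Measure.restrict_restrict hset]
  rcases eq_or_ne y ∞ with rfl | hy
  · rw [ENNReal.top_rpow_of_pos hb, ENNReal.top_div_of_ne_top ENNReal.ofReal_ne_top]
    refine (ENNReal.eq_top_of_forall_nnreal_le fun r => ?_)
    have hz : (0 : ℝ) ≤ (r * b) ^ (1 / b) := by positivity
    calc (r : ℝ≥0∞) = ENNReal.ofReal (((r * b : ℝ) ^ (1 / b)) ^ b / b) := by
          rw [← Real.rpow_mul (by positivity), one_div_mul_cancel hb.ne', Real.rpow_one,
            mul_div_cancel_right₀ _ hb.ne', ENNReal.ofReal_coe_nnreal]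
      _ = _ := (lintegral_Ioo_rpow hb hz).symm
      _ ≤ _ := lintegral_mono_set (show Set.Ioo 0 _ ⊆ {l : ℝ | ENNReal.ofReal l < ∞} ∩ Set.Ioi 0 from fun l hl =>
        ⟨ENNReal.ofReal_lt_top, hl.1⟩)
  · lift y to NNReal using hy
    have : {l : ℝ | ENNReal.ofReal l < y} ∩ Set.Ioi 0 = Set.Ioo 0 (y : ℝ) := by
      ext l
      simp only [Set.mem_inter_iff, Set.mem_ofPred_eq, Set.mem_Ioi, Set.mem_Ioo]
      constructor
      · rintro ⟨h1, h2⟩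
        refine ⟨h2, ?_⟩
        rw [← ENNReal.ofReal_coe_nnreal] at h1
        exact (ENNReal.ofReal_lt_ofReal_iff_of_nonneg h2.le).1 h1
      · rintro ⟨h1, h2⟩
        refine ⟨?_, h1⟩
        rw [← ENNReal.ofReal_coe_nnreal]
        exact (ENNReal.ofReal_lt_ofReal_iff_of_nonneg h1.le).2 h2
    rw [this, lintegral_Ioo_rpow hb y.coe_nonneg, ENNReal.ofReal_div_of_pos hb,
      ← ENNReal.ofReal_rpow_of_nonneg y.coe_nonneg hb.le, ENNReal.ofReal_coe_nnreal]

/-- The strong type inequality for the martingale maximal function. -/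
theorem lintegral_cellMax_rpow_le [SFinite μ] [Countable ι] [MeasurableSpace ι]
    [DiscreteMeasurableSpace ι] {c : ℕ → X → ι} (hc : ∀ i, Measurable (c i))
    (href : ∀ i x y, c (i + 1) x = c (i + 1) y → c i x = c i y)
    {a : ℝ} (ha : 1 < a) {h : X → ℝ≥0∞} (hh : Measurable h) :
    ∫⁻ x, cellMax μ c h x ^ a ∂μ ≤
      ENNReal.ofReal (2 ^ a * (a / (a - 1))) * ∫⁻ x, h x ^ a ∂μ := by
  have ha0 : 0 < a := by linarith
  have ha1 : 0 < a - 1 := by linarith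
  have hM := measurable_cellMax (μ := μ) hc h
  have hlayer : ∀ x, cellMax μ c h x ^ a = ENNReal.ofReal (2 ^ a * a) *
      ∫⁻ l in Set.Ioi (0 : ℝ), {l : ℝ | ENNReal.ofReal l < cellMax μ c h x / 2}.indicator
        (fun l => ENNReal.ofReal (l ^ (a - 1))) l := by
    intro x
    rw [lintegral_rpow_indicator_lt ha0, ENNReal.ofReal_mul (by positivity),
      ENNReal.div_rpow_of_nonneg _ _ ha0.le, ← ENNReal.ofReal_rpow_of_pos two_pos,
      ENNReal.ofReal_ofNat, mul_assoc,
      ENNReal.mul_div_cancel (ENNReal.ofReal_pos.2 ha0).ne' ENNReal.ofReal_ne_top,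
      ENNReal.mul_div_cancel]
    · simp
    · simp
  have hmeas1 : Measurable (Function.uncurry fun (x : X) (l : ℝ) =>
      {l : ℝ | ENNReal.ofReal l < cellMax μ c h x / 2}.indicator
        (fun l => ENNReal.ofReal (l ^ (a - 1))) l) := by
    have : MeasurableSet {z : X × ℝ | ENNReal.ofReal z.2 < cellMax μ c h z.1 / 2} :=
      measurableSet_lt (ENNReal.measurable_ofReal.comp measurable_snd)
        ((hM.comp measurable_fst).div_const _)
    exact (Measurable.indicator (by fun_prop) this :
      Measurable ({z : X × ℝ | ENNReal.ofReal z.2 < cellMax μ c h z.1 / 2}.indicator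
        (fun z : X × ℝ => ENNReal.ofReal (z.2 ^ (a - 1)))))
  have hmeas2 : Measurable (Function.uncurry fun (x : X) (l : ℝ) =>
      {l : ℝ | ENNReal.ofReal l < h x}.indicator
        (fun l => ENNReal.ofReal (l ^ (a - 1 - 1))) l * h x) := by
    have : MeasurableSet {z : X × ℝ | ENNReal.ofReal z.2 < h z.1} :=
      measurableSet_lt (ENNReal.measurable_ofReal.comp measurable_snd) (hh.comp measurable_fst)
    exact (Measurable.indicator (by fun_prop) this :
      Measurable ({z : X × ℝ | ENNReal.ofReal z.2 < h z.1}.indicator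
        (fun z : X × ℝ => ENNReal.ofReal (z.2 ^ (a - 1 - 1))))).mul (hh.comp measurable_fst)
  have hkey : ∀ l ∈ Set.Ioi (0 : ℝ),
      ∫⁻ x, {l : ℝ | ENNReal.ofReal l < cellMax μ c h x / 2}.indicator
        (fun l => ENNReal.ofReal (l ^ (a - 1))) l ∂μ ≤
      ∫⁻ x, {l : ℝ | ENNReal.ofReal l < h x}.indicator
        (fun l => ENNReal.ofReal (l ^ (a - 1 - 1))) l * h x ∂μ := by
    intro l hl
    have hl' : (0 : ℝ) < l := hl
    have hpow : ENNReal.ofReal (l ^ (a - 1)) =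
        ENNReal.ofReal (l ^ (a - 1 - 1)) * ENNReal.ofReal l := by
      rw [← ENNReal.ofReal_mul (by positivity), Real.rpow_sub_one hl'.ne' (a - 1),
        div_mul_cancel₀ _ hl'.ne']
    have hset : MeasurableSet {x | 2 * ENNReal.ofReal l < cellMax μ c h x} :=
      measurableSet_lt measurable_const hM
    calc ∫⁻ x, {l : ℝ | ENNReal.ofReal l < cellMax μ c h x / 2}.indicator
          (fun l => ENNReal.ofReal (l ^ (a - 1))) l ∂μ
        = ∫⁻ x, {x | 2 * ENNReal.ofReal l < cellMax μ c h x}.indicator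
          (fun _ => ENNReal.ofReal (l ^ (a - 1))) x ∂μ := by
          congr 1 with x
          simp only [Set.indicator, Set.mem_ofPred_eq,
            ENNReal.lt_div_iff_mul_lt (Or.inl two_ne_zero) (Or.inl ENNReal.ofNat_ne_top), mul_comm]
      _ = ENNReal.ofReal (l ^ (a - 1 - 1)) *
          (ENNReal.ofReal l * μ {x | 2 * ENNReal.ofReal l < cellMax μ c h x}) := by
          rw [lintegral_indicator_const hset, hpow, mul_assoc]
      _ ≤ ENNReal.ofReal (l ^ (a - 1 - 1)) *
          ∫⁻ x, {y | ENNReal.ofReal l < h y}.indicator h x ∂μ := by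
          gcongr
          exact mul_measure_two_mul_lt_cellMax_le hc href hh ENNReal.ofReal_ne_top
      _ = _ := by
          rw [← lintegral_const_mul' _ _ ENNReal.ofReal_ne_top]
          congr 1 with x
          simp [Set.indicator]
  calc ∫⁻ x, cellMax μ c h x ^ a ∂μ
      = ENNReal.ofReal (2 ^ a * a) * ∫⁻ x, (∫⁻ l in Set.Ioi (0 : ℝ),
          {l : ℝ | ENNReal.ofReal l < cellMax μ c h x / 2}.indicator
          (fun l => ENNReal.ofReal (l ^ (a - 1))) l) ∂μ := by
        rw [← lintegral_const_mul' _ _ ENNReal.ofReal_ne_top]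
        exact lintegral_congr hlayer
    _ ≤ ENNReal.ofReal (2 ^ a * a) * ∫⁻ x, (∫⁻ l in Set.Ioi (0 : ℝ),
          {l : ℝ | ENNReal.ofReal l < h x}.indicator
          (fun l => ENNReal.ofReal (l ^ (a - 1 - 1))) l * h x) ∂μ := by
        rw [lintegral_lintegral_swap hmeas1.aemeasurable,
          lintegral_lintegral_swap hmeas2.aemeasurable]
        gcongr ENNReal.ofReal (2 ^ a * a) * ?_
        exact setLIntegral_mono' measurableSet_Ioi hkey
    _ = ENNReal.ofReal (2 ^ a * a) * ∫⁻ x, h x ^ a * (ENNReal.ofReal (a - 1))⁻¹ ∂μ := by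
        congr 2 with x
        have hm : Measurable ({l : ℝ | ENNReal.ofReal l < h x}.indicator
            (fun l => ENNReal.ofReal (l ^ (a - 1 - 1)))) :=
          Measurable.indicator (by fun_prop)
            (measurableSet_lt ENNReal.measurable_ofReal measurable_const)
        rw [lintegral_mul_const _ hm, lintegral_rpow_indicator_lt ha1, div_eq_mul_inv,
          mul_right_comm]
        congr 1
        conv_lhs => rw [← ENNReal.rpow_one (h x), ← ENNReal.rpow_mul, one_mul]
        rw [← ENNReal.rpow_add_of_nonneg _ _ ha1.le zero_le_one, sub_add_cancel]
    _ = _ := by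
        rw [lintegral_mul_const _ (hh.pow_const a), ← ENNReal.ofReal_inv_of_pos ha1,
          mul_comm (∫⁻ x, h x ^ a ∂μ), ← mul_assoc, ← ENNReal.ofReal_mul (by positivity),
          mul_assoc, div_eq_mul_inv]

end Maximal

section Dyadic

variable {n : ℕ}

/-- The position of the dyadic cube of side length `2^{-k}` containing `x`. -/
def dyadicIndex (k : ℤ) (x : EuclideanSpace ℝ (Fin n)) : Fin n → ℤ :=
  fun i => ⌊(2 : ℝ) ^ k * x i⌋

theorem dyadicCube_eq_preimage (k : ℤ) (m : Fin n → ℤ) :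
    dyadicCube n k m = dyadicIndex k ⁻¹' {m} := by
  ext x
  simp [dyadicCube, dyadicIndex, funext_iff, Int.floor_eq_iff]

theorem measurable_dyadicIndex (k : ℤ) :
    Measurable (dyadicIndex k : EuclideanSpace ℝ (Fin n) → Fin n → ℤ) := by
  refine measurable_pi_iff.2 fun i => Int.measurable_floor.comp ?_
  fun_prop

theorem measurableSet_dyadicCube (k : ℤ) (m : Fin n → ℤ) : MeasurableSet (dyadicCube n k m) := by
  rw [dyadicCube_eq_preimage]
  exact measurable_dyadicIndex k (measurableSet_singleton m)

theorem dyadicIndex_eq_of_le {j k : ℤ} (hjk : j ≤ k) {x y : EuclideanSpace ℝ (Fin n)}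
    (h : dyadicIndex k x = dyadicIndex k y) : dyadicIndex j x = dyadicIndex j y := by
  obtain ⟨l, rfl⟩ := Int.le.dest hjk
  have key : ∀ z : EuclideanSpace ℝ (Fin n), ∀ i,
      dyadicIndex j z i = dyadicIndex (j + l) z i / ((2 ^ l : ℕ) : ℤ) := by
    intro z i
    simp only [dyadicIndex]
    rw [← Int.natCast_mul_floor_div_cancel (n := 2 ^ l) (by positivity)]
    congr 2
    rw [zpow_add₀ two_ne_zero, zpow_natCast]
    push_cast
    ring
  ext i
  rw [key, key, h]

theorem volume_dyadicCube (k : ℤ) (m : Fin n → ℤ) :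
    volume (dyadicCube n k m) = ENNReal.ofReal (2 ^ (-k)) ^ n := by
  have hk : (0 : ℝ) < 2 ^ k := by positivity
  have hset : dyadicCube n k m = WithLp.ofLp ⁻¹'
      (Set.univ.pi fun i => Set.Ico ((m i : ℝ) / 2 ^ k) (((m i : ℝ) + 1) / 2 ^ k)) := by
    ext x
    simp [dyadicCube, div_le_iff₀ hk, lt_div_iff₀ hk, mul_comm]
  rw [hset, (PiLp.volume_preserving_ofLp (Fin n)).measure_preimage
    (MeasurableSet.univ_pi fun i => measurableSet_Ico).nullMeasurableSet, volume_pi_pi]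
  simp only [Real.volume_Ico, ← sub_div, add_sub_cancel_left, one_div, ← zpow_neg,
    Finset.prod_const, Finset.card_univ, Fintype.card_fin]

theorem volume_dyadicCube_ne_zero (k : ℤ) (m : Fin n → ℤ) : volume (dyadicCube n k m) ≠ 0 := by
  rw [volume_dyadicCube]
  exact pow_ne_zero _ (ENNReal.ofReal_pos.2 (by positivity)).ne'

theorem volume_dyadicCube_ne_top (k : ℤ) (m : Fin n → ℤ) : volume (dyadicCube n k m) ≠ ∞ := by
  rw [volume_dyadicCube]
  exact ENNReal.pow_ne_top ENNReal.ofReal_ne_top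

theorem volume_dyadicCube_le {j k : ℤ} (hjk : j ≤ k) (l m : Fin n → ℤ) :
    volume (dyadicCube n k l) ≤ volume (dyadicCube n j m) := by
  rw [volume_dyadicCube, volume_dyadicCube]
  gcongr
  norm_num

theorem setAvg_rpow_le_of_exponent_le {Q : Set (EuclideanSpace ℝ (Fin n))} (h0 : volume Q ≠ 0)
    (htop : volume Q ≠ ∞) {F : EuclideanSpace ℝ (Fin n) → ℝ≥0∞} (hF : Measurable F) {r q : ℝ}
    (hr : 0 < r) (hrq : r ≤ q) :
    (setAvg Q fun x => F x ^ r) ^ (1 / r) ≤ (setAvg Q fun x => F x ^ q) ^ (1 / q) := by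
  have hprob : IsProbabilityMeasure ((volume Q)⁻¹ • volume.restrict Q) :=
    ⟨by simp [ENNReal.inv_mul_cancel h0 htop]⟩
  have := eLpNorm'_le_eLpNorm'_of_exponent_le hr hrq ((volume Q)⁻¹ • volume.restrict Q)
    hF.aestronglyMeasurable
  simpa [eLpNorm', setAvg, lintegral_smul_measure] using this

theorem setAvg_le_cellMax {k₀ k : ℤ} (hk : k₀ ≤ k) {m₀ m : Fin n → ℤ}
    {x : EuclideanSpace ℝ (Fin n)} (hx₀ : x ∈ dyadicCube n k₀ m₀) (hx : x ∈ dyadicCube n k m)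
    (h : EuclideanSpace ℝ (Fin n) → ℝ≥0∞) :
    setAvg (dyadicCube n k m) h ≤
      cellMax volume (fun i : ℕ => dyadicIndex (k₀ + i)) ((dyadicCube n k₀ m₀).indicator h) x := by
  obtain ⟨l, rfl⟩ := Int.le.dest hk
  refine le_trans ?_ (le_iSup _ l)
  have hx' : dyadicIndex (k₀ + l) x = m := by
    rw [dyadicCube_eq_preimage] at hx
    exact hx
  have hx₀' : dyadicIndex k₀ x = m₀ := by
    rw [dyadicCube_eq_preimage] at hx₀
    exact hx₀
  simp only [cellAvg]
  rw [hx', ← dyadicCube_eq_preimage, setAvg]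
  refine le_of_eq ?_
  congr 1
  refine setLIntegral_congr_fun (measurableSet_dyadicCube _ _) fun y hy => ?_
  rw [dyadicCube_eq_preimage] at hy
  have hy' : dyadicIndex (k₀ + l) y = m := hy
  have : y ∈ dyadicCube n k₀ m₀ := by
    rw [dyadicCube_eq_preimage]
    exact (dyadicIndex_eq_of_le hk (hy'.trans hx'.symm)).trans hx₀'
  simp [this]

theorem lintegral_cellMax_dyadic_rpow_le {k₀ : ℤ} {m₀ : Fin n → ℤ} {r q : ℝ} (hr : 0 < r)
    (hrq : r < q) {F : EuclideanSpace ℝ (Fin n) → ℝ≥0∞} (hF : Measurable F) :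
    ∫⁻ x, cellMax volume (fun i : ℕ => dyadicIndex (k₀ + i))
        ((dyadicCube n k₀ m₀).indicator fun y => F y ^ r) x ^ (q / r) ≤
      ENNReal.ofReal (2 ^ (q / r) * (q / r / (q / r - 1))) *
        ∫⁻ x in dyadicCube n k₀ m₀, F x ^ q := by
  have hQ := measurableSet_dyadicCube k₀ m₀
  have ha : 1 < q / r := (one_lt_div hr).2 hrq
  refine (lintegral_cellMax_rpow_le (fun i => measurable_dyadicIndex _)
    (fun i x y => dyadicIndex_eq_of_le (by push_cast; linarith)) ha
    ((hF.pow_const r).indicator hQ)).trans_eq ?_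
  rw [← lintegral_indicator hQ]
  congr 2 with x
  by_cases hx : x ∈ dyadicCube n k₀ m₀
  · simp [hx, ← ENNReal.rpow_mul, mul_div_cancel₀ _ hr.ne']
  · simp [hx, hr, hr.trans hrq]

/-- Hölder's inequality combined with the maximal inequality on a fixed dyadic cube. -/
theorem setAvg_cellMax_mul_le {k₀ : ℤ} {m₀ : Fin n → ℤ} {q q₁ q₂ r₁ r₂ : ℝ} (hq0 : 0 < q)
    (hr₁ : 0 < r₁) (hr₁q : r₁ < q₁) (hr₂ : 0 < r₂) (hr₂q : r₂ < q₂)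
    (hq : 1 / q = 1 / q₁ + 1 / q₂) {F G : EuclideanSpace ℝ (Fin n) → ℝ≥0∞}
    (hF : Measurable F) (hG : Measurable G) :
    (setAvg (dyadicCube n k₀ m₀) fun x =>
      (cellMax volume (fun i : ℕ => dyadicIndex (k₀ + i))
          ((dyadicCube n k₀ m₀).indicator fun y => F y ^ r₁) x ^ (1 / r₁) *
        cellMax volume (fun i : ℕ => dyadicIndex (k₀ + i))
          ((dyadicCube n k₀ m₀).indicator fun y => G y ^ r₂) x ^ (1 / r₂)) ^ q) ≤
    (ENNReal.ofReal (2 ^ (q₁ / r₁) * (q₁ / r₁ / (q₁ / r₁ - 1))) ^ (q / q₁) *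
      ENNReal.ofReal (2 ^ (q₂ / r₂) * (q₂ / r₂ / (q₂ / r₂ - 1))) ^ (q / q₂)) *
      ((setAvg (dyadicCube n k₀ m₀) fun x => F x ^ q₁) ^ (1 / q₁) *
        (setAvg (dyadicCube n k₀ m₀) fun x => G x ^ q₂) ^ (1 / q₂)) ^ q := by
  have hq₁ : 0 < q₁ := hr₁.trans hr₁q
  have hq₂ : 0 < q₂ := hr₂.trans hr₂q
  set Q := dyadicCube n k₀ m₀
  set M₁ := cellMax volume (fun i : ℕ => dyadicIndex (k₀ + i)) (Q.indicator fun y => F y ^ r₁)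
  set M₂ := cellMax volume (fun i : ℕ => dyadicIndex (k₀ + i)) (Q.indicator fun y => G y ^ r₂)
  set K₁ := ENNReal.ofReal (2 ^ (q₁ / r₁) * (q₁ / r₁ / (q₁ / r₁ - 1)))
  set K₂ := ENNReal.ofReal (2 ^ (q₂ / r₂) * (q₂ / r₂ / (q₂ / r₂ - 1)))
  have hsum : q / q₁ + q / q₂ = 1 := by
    have : q * (1 / q) = q * (1 / q₁ + 1 / q₂) := by rw [hq]
    rw [mul_one_div_cancel hq0.ne'] at this
    rw [this]
    ring
  have hpos₁ : 0 < q / q₁ := by positivity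
  have hpos₂ : 0 < q / q₂ := by positivity
  have hconj : (q₁ / q).HolderConjugate (q₂ / q) := by
    refine Real.holderConjugate_iff.2 ⟨?_, by rw [inv_div, inv_div, hsum]⟩
    rw [one_lt_div hq0, ← div_lt_one hq₁]
    linarith
  have hm₁ : Measurable M₁ := measurable_cellMax (fun i => measurable_dyadicIndex _) _
  have hm₂ : Measurable M₂ := measurable_cellMax (fun i => measurable_dyadicIndex _) _
  have h₁ : ∫⁻ x in Q, M₁ x ^ (q₁ / r₁) ≤ K₁ * ∫⁻ x in Q, F x ^ q₁ :=
    (setLIntegral_le_lintegral _ _).trans (lintegral_cellMax_dyadic_rpow_le hr₁ hr₁q hF)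
  have h₂ : ∫⁻ x in Q, M₂ x ^ (q₂ / r₂) ≤ K₂ * ∫⁻ x in Q, G x ^ q₂ :=
    (setLIntegral_le_lintegral _ _).trans (lintegral_cellMax_dyadic_rpow_le hr₂ hr₂q hG)
  have hholder : ∫⁻ x in Q, (M₁ x ^ (1 / r₁) * M₂ x ^ (1 / r₂)) ^ q ≤
      (∫⁻ x in Q, M₁ x ^ (q₁ / r₁)) ^ (q / q₁) * (∫⁻ x in Q, M₂ x ^ (q₂ / r₂)) ^ (q / q₂) := by
    have := ENNReal.lintegral_mul_le_Lp_mul_Lq (volume.restrict Q) hconj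
      (hm₁.pow_const (q / r₁)).aemeasurable (hm₂.pow_const (q / r₂)).aemeasurable
    have e₁ : q / r₁ * (q₁ / q) = q₁ / r₁ := by field_simp
    have e₂ : q / r₂ * (q₂ / q) = q₂ / r₂ := by field_simp
    simp only [← ENNReal.rpow_mul, e₁, e₂, one_div_div, Pi.mul_apply] at this
    convert this using 3 with x
    rw [ENNReal.mul_rpow_of_nonneg _ _ hq0.le, ← ENNReal.rpow_mul, ← ENNReal.rpow_mul,
      one_div_mul_eq_div, one_div_mul_eq_div]
  have hV : (volume Q)⁻¹ = (volume Q)⁻¹ ^ (q / q₁) * (volume Q)⁻¹ ^ (q / q₂) := by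
    rw [← ENNReal.rpow_add_of_nonneg _ _ hpos₁.le hpos₂.le, hsum, ENNReal.rpow_one]
  calc (volume Q)⁻¹ * ∫⁻ x in Q, (M₁ x ^ (1 / r₁) * M₂ x ^ (1 / r₂)) ^ q
      ≤ ((volume Q)⁻¹ ^ (q / q₁) * (volume Q)⁻¹ ^ (q / q₂)) *
        ((K₁ * ∫⁻ x in Q, F x ^ q₁) ^ (q / q₁) * (K₂ * ∫⁻ x in Q, G x ^ q₂) ^ (q / q₂)) := by
        rw [← hV]
        gcongr
        exact hholder.trans (by gcongr)
    _ = _ := by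
        simp only [setAvg, ENNReal.mul_rpow_of_nonneg _ _ hpos₁.le,
          ENNReal.mul_rpow_of_nonneg _ _ hpos₂.le, ENNReal.mul_rpow_of_nonneg _ _ hq0.le,
          ← ENNReal.rpow_mul, ENNReal.mul_rpow_of_nonneg _ _ (one_div_pos.2 hq₁).le,
          ENNReal.mul_rpow_of_nonneg _ _ (one_div_pos.2 hq₂).le, one_div_mul_eq_div]
        ring

end Dyadic

section Pointwise

variable {n : ℕ}

/-- The contribution of a single cube to the maximal operator: small cubes are controlled by the
maximal functions localized to a given cube, large cubes by the supremum `N`. -/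
theorem Mop_rpow_le {k₀ : ℤ} {m₀ : Fin n → ℤ} {α p q q₁ q₂ r₁ r₂ s t : ℝ} (hα0 : 0 ≤ α)
    (hr₁ : 0 < r₁) (hr₁q : r₁ < q₁) (hr₂ : 0 < r₂) (hr₂q : r₂ < q₂)
    (ht0 : 0 < t) (hs0 : 0 < s) (hp0 : 0 < p)
    (hs : 1 / s = 1 / p - α / n) (htsqp : t / s = q / p)
    {F G : EuclideanSpace ℝ (Fin n) → ℝ≥0∞} (hF : Measurable F) (hG : Measurable G) {N : ℝ≥0∞}
    (hN : ∀ k m, volume (dyadicCube n k m) ^ (1 / p) *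
      (setAvg (dyadicCube n k m) fun x => F x ^ q₁) ^ (1 / q₁) *
      (setAvg (dyadicCube n k m) fun x => G x ^ q₂) ^ (1 / q₂) ≤ N)
    {x : EuclideanSpace ℝ (Fin n)} (hx : x ∈ dyadicCube n k₀ m₀) :
    Mop α r₁ r₂ F G x ^ t ≤
      N ^ t * (volume (dyadicCube n k₀ m₀))⁻¹ ^ (q / p) + N ^ (t - q) *
        (cellMax volume (fun i : ℕ => dyadicIndex (k₀ + i))
            ((dyadicCube n k₀ m₀).indicator fun y => F y ^ r₁) x ^ (1 / r₁) *
          cellMax volume (fun i : ℕ => dyadicIndex (k₀ + i))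
            ((dyadicCube n k₀ m₀).indicator fun y => G y ^ r₂) x ^ (1 / r₂)) ^ q := by
  rw [← ENNReal.le_rpow_inv_iff ht0]
  refine iSup_le fun Q => iSup_le fun hQ => iSup_le fun hxQ => ?_
  obtain ⟨k, m, rfl⟩ := hQ
  rw [ENNReal.le_rpow_inv_iff ht0, mul_assoc]
  have h0 := volume_dyadicCube_ne_zero k m
  have htop := volume_dyadicCube_ne_top k m
  set v := volume (dyadicCube n k m)
  set A := (setAvg (dyadicCube n k m) fun y => F y ^ r₁) ^ (1 / r₁) *
    (setAvg (dyadicCube n k m) fun z => G z ^ r₂) ^ (1 / r₂)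
  have hAN : v ^ (1 / p) * A ≤ N := by
    refine le_trans ?_ (hN k m)
    rw [mul_assoc]
    gcongr v ^ (1 / p) * (?_ * ?_)
    · exact setAvg_rpow_le_of_exponent_le h0 htop hF hr₁ hr₁q.le
    · exact setAvg_rpow_le_of_exponent_le h0 htop hG hr₂ hr₂q.le
  have hqt : q = p / s * t := by
    field_simp at htsqp ⊢
    linarith
  have hθ : 1 / p * (1 - p / s) = α / n := by
    have : α / n = 1 / p - 1 / s := by linarith
    rw [this]
    field_simp
  have hθ0 : 0 ≤ 1 - p / s := by
    have h1 : 0 ≤ α / n := by positivity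
    rw [← hθ] at h1
    exact nonneg_of_mul_nonneg_right h1 (by positivity)
  rcases le_total k₀ k with hk | hk
  · refine le_trans ?_ le_add_self
    have hAsplit : v ^ (α / n) * A = (v ^ (1 / p) * A) ^ (1 - p / s) * A ^ (p / s) := by
      rw [ENNReal.mul_rpow_of_nonneg _ _ hθ0, ← ENNReal.rpow_mul, hθ, mul_assoc,
        ← ENNReal.rpow_add_of_nonneg _ _ hθ0 (by positivity), sub_add_cancel, ENNReal.rpow_one]
    have htq : t - q = (1 - p / s) * t := by
      rw [hqt]
      ring
    rw [hAsplit, ENNReal.mul_rpow_of_nonneg _ _ ht0.le, ← ENNReal.rpow_mul, ← ENNReal.rpow_mul,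
      ← htq, ← hqt]
    have h1 : 0 ≤ t - q := htq ▸ mul_nonneg hθ0 ht0.le
    have h2 : 0 ≤ q := by
      rw [hqt]
      positivity
    gcongr ?_ ^ (t - q) * ?_ ^ q
    gcongr
    · exact setAvg_le_cellMax hk hx hxQ _
    · exact setAvg_le_cellMax hk hx hxQ _
  · refine le_trans ?_ le_self_add
    rw [← htsqp, ← one_div_mul_eq_div s t, ENNReal.rpow_mul, ← ENNReal.mul_rpow_of_nonneg _ _ ht0.le]
    gcongr ?_ ^ t
    have hexp : α / n = -(1 / s) + 1 / p := by linarith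
    rw [hexp, ENNReal.rpow_add _ _ h0 htop, mul_assoc, mul_comm N, ENNReal.rpow_neg,
      ← ENNReal.inv_rpow]
    gcongr
    exact volume_dyadicCube_le hk m₀ m

end Pointwise

/-- Lemma 3.7 of the paper: unweighted bound for the bilinear fractional maximal
operator `M_{α,R⃗}` on Morrey spaces. -/
theorem maximal_Morrey_unweighted
    (n : ℕ) (hn : 0 < n) (α p q q₁ q₂ r₁ r₂ s t : ℝ)
    (hα0 : 0 ≤ α) (hαn : α < 2 * n)
    (hr₁ : 0 < r₁) (hr₁q : r₁ < q₁) (hr₂ : 0 < r₂) (hr₂q : r₂ < q₂)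
    (hq : 1 / q = 1 / q₁ + 1 / q₂)
    (ht0 : 0 < t) (hts : t ≤ s) (hq0 : 0 < q) (hqp : q ≤ p)
    (hs : 1 / s = 1 / p - α / n) (htsqp : t / s = q / p) :
    ∃ C : ℝ≥0∞, C ≠ ∞ ∧
      ∀ f g : EuclideanSpace ℝ (Fin n) → ℝ, Measurable f → Measurable g →
        morreyNorm s t
            (Mop α r₁ r₂ (fun y => ENNReal.ofReal |f y|) (fun y => ENNReal.ofReal |g y|)) ≤
          C * ⨆ (Q : Set (EuclideanSpace ℝ (Fin n))) (_ : IsDyadicCube Q),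
            volume Q ^ (1 / p) *
              (setAvg Q fun x => ENNReal.ofReal |f x| ^ q₁) ^ (1 / q₁) *
              (setAvg Q fun x => ENNReal.ofReal |g x| ^ q₂) ^ (1 / q₂) := by
  have hs0 : 0 < s := ht0.trans_le hts
  have hp0 : 0 < p := hq0.trans_le hqp
  have hq₁ : 0 < q₁ := hr₁.trans hr₁q
  have hq₂ : 0 < q₂ := hr₂.trans hr₂q
  have hqt : q ≤ t := by
    have h1 : 1 / s ≤ 1 / p := by
      have : 0 ≤ α / n := by positivity
      linarith
    have h2 : p ≤ s := (one_div_le_one_div hs0 hp0).1 h1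
    have h3 : t = q / p * s := by rw [← htsqp, div_mul_cancel₀ _ hs0.ne']
    rw [h3, div_mul_eq_mul_div, le_div_iff₀ hp0]
    gcongr
  set K := ENNReal.ofReal (2 ^ (q₁ / r₁) * (q₁ / r₁ / (q₁ / r₁ - 1))) ^ (q / q₁) *
    ENNReal.ofReal (2 ^ (q₂ / r₂) * (q₂ / r₂ / (q₂ / r₂ - 1))) ^ (q / q₂)
  have hKtop : K ≠ ∞ :=
    ENNReal.mul_ne_top (ENNReal.rpow_ne_top_of_nonneg (by positivity) ENNReal.ofReal_ne_top)
      (ENNReal.rpow_ne_top_of_nonneg (by positivity) ENNReal.ofReal_ne_top)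
  refine ⟨(1 + K) ^ (1 / t), ENNReal.rpow_ne_top_of_nonneg (by positivity)
    (ENNReal.add_ne_top.2 ⟨ENNReal.one_ne_top, hKtop⟩), fun f g hf hg => ?_⟩
  have hF : Measurable fun x => ENNReal.ofReal |f x| := by fun_prop
  have hG : Measurable fun x => ENNReal.ofReal |g x| := by fun_prop
  set N := ⨆ (Q : Set (EuclideanSpace ℝ (Fin n))) (_ : IsDyadicCube Q),
    volume Q ^ (1 / p) *
      (setAvg Q fun x => ENNReal.ofReal |f x| ^ q₁) ^ (1 / q₁) *
      (setAvg Q fun x => ENNReal.ofReal |g x| ^ q₂) ^ (1 / q₂)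
  have hN : ∀ k m, volume (dyadicCube n k m) ^ (1 / p) *
      (setAvg (dyadicCube n k m) fun x => ENNReal.ofReal |f x| ^ q₁) ^ (1 / q₁) *
      (setAvg (dyadicCube n k m) fun x => ENNReal.ofReal |g x| ^ q₂) ^ (1 / q₂) ≤ N :=
    fun k m => le_iSup₂_of_le (dyadicCube n k m) ⟨k, m, rfl⟩ le_rfl
  clear_value N
  refine iSup₂_le fun Q hQ => ?_
  obtain ⟨k₀, m₀, rfl⟩ := hQ
  have h0 := volume_dyadicCube_ne_zero k₀ m₀
  have htop := volume_dyadicCube_ne_top k₀ m₀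
  have hholder := setAvg_cellMax_mul_le (k₀ := k₀) (m₀ := m₀) hq0 hr₁ hr₁q hr₂ hr₂q hq hF hG
  have hN₀ := hN k₀ m₀
  set V := volume (dyadicCube n k₀ m₀)
  set D := (setAvg (dyadicCube n k₀ m₀) fun x => ENNReal.ofReal |f x| ^ q₁) ^ (1 / q₁) *
      (setAvg (dyadicCube n k₀ m₀) fun x => ENNReal.ofReal |g x| ^ q₂) ^ (1 / q₂)
  have hD : D ≤ N * V⁻¹ ^ (1 / p) := by
    rw [mul_assoc] at hN₀
    rw [ENNReal.inv_rpow, ← ENNReal.div_eq_inv_mul.trans (mul_comm _ _)]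
    rw [ENNReal.le_div_iff_mul_le
      (Or.inl (ENNReal.rpow_pos (pos_iff_ne_zero.2 h0) htop).ne')
      (Or.inl (ENNReal.rpow_ne_top_of_nonneg (by positivity) htop)), mul_comm]
    exact hN₀
  have havg : (setAvg (dyadicCube n k₀ m₀) fun x => Mop α r₁ r₂
      (fun y => ENNReal.ofReal |f y|) (fun y => ENNReal.ofReal |g y|) x ^ t) ≤
      (1 + K) * (N ^ t * V⁻¹ ^ (q / p)) := by
    calc _ ≤ V⁻¹ * ∫⁻ x in dyadicCube n k₀ m₀, (N ^ t * V⁻¹ ^ (q / p) + N ^ (t - q) * _) := by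
          refine mul_le_mul_right (setLIntegral_mono' (measurableSet_dyadicCube _ _) fun x hx =>
            Mop_rpow_le hα0 hr₁ hr₁q hr₂ hr₂q ht0 hs0 hp0 hs htsqp hF hG hN hx) _
      _ = N ^ t * V⁻¹ ^ (q / p) + N ^ (t - q) * setAvg (dyadicCube n k₀ m₀) _ := by
          rw [lintegral_add_left measurable_const, setLIntegral_const, lintegral_const_mul, mul_add,
            mul_left_comm, ENNReal.inv_mul_cancel h0 htop, mul_one, mul_left_comm, setAvg]
          exact (((measurable_cellMax (fun i => measurable_dyadicIndex _) _).pow_const _).mul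
            ((measurable_cellMax (fun i => measurable_dyadicIndex _) _).pow_const _)).pow_const _
      _ ≤ N ^ t * V⁻¹ ^ (q / p) + N ^ (t - q) * (K * (N * V⁻¹ ^ (1 / p)) ^ q) := by
          gcongr
          exact hholder.trans (by gcongr)
      _ = _ := by
          have hNt : N ^ t = N ^ (t - q) * N ^ q := by
            rw [← ENNReal.rpow_add_of_nonneg _ _ (by linarith) hq0.le, sub_add_cancel]
          rw [ENNReal.mul_rpow_of_nonneg _ _ hq0.le, ← ENNReal.rpow_mul, one_div_mul_eq_div, hNt]
          ring
  calc _ ≤ V ^ (1 / s) * ((1 + K) * (N ^ t * V⁻¹ ^ (q / p))) ^ (1 / t) := by gcongr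
    _ = (1 + K) ^ (1 / t) * N * (V ^ (1 / s) * V⁻¹ ^ (1 / s)) := by
        have ht' : 0 ≤ 1 / t := by positivity
        have e : q / p * (1 / t) = 1 / s := by
          rw [← htsqp]
          field_simp
        rw [ENNReal.mul_rpow_of_nonneg _ _ ht', ENNReal.mul_rpow_of_nonneg _ _ ht',
          ← ENNReal.rpow_mul, ← ENNReal.rpow_mul, e, mul_one_div_cancel ht0.ne', ENNReal.rpow_one]
        ring
    _ = (1 + K) ^ (1 / t) * N := by
        rw [← ENNReal.mul_rpow_of_nonneg _ _ (by positivity), ENNReal.mul_inv_cancel h0 htop,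
          ENNReal.one_rpow, mul_one]
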